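/- The graph K_15 □ K_3 has an L_8-decomposition. -/

import Mathlib

open SimpleGraph

/-- The sunlet graph `L₈` on 8 vertices: a 4-cycle on vertices `0,1,2,3`
together with pendant vertices `4,5,6,7`, where pendant `i+4` is attached
to cycle vertex `i`. -/
def sunlet8 : SimpleGraph (Fin 8) :=
  SimpleGraph.fromRel (fun a b =>
    (a.val < 4 ∧ b.val < 4 ∧ b.val = (a.val + 1) % 4) ∨ (a.val < 4 ∧ b.val = a.val + 4))

/-- A set of edges is a copy of the sunlet graph `L₈` if it is the image of the
edge set of `sunlet8` under an injective map of vertices. -/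
def IsSunletCopy {V : Type*} (s : Set (Sym2 V)) : Prop :=
  ∃ f : Fin 8 → V, Function.Injective f ∧ s = Sym2.map f '' sunlet8.edgeSet

/-- A graph `G` has an `L₈`-decomposition if its edge set can be partitioned into
parts, each of which induces a subgraph isomorphic to the sunlet graph `L₈`. -/
def HasSunletDecomposition {V : Type*} (G : SimpleGraph V) : Prop :=
  ∃ P : Set (Set (Sym2 V)),
    ⋃₀ P = G.edgeSet ∧ P.PairwiseDisjoint id ∧ ∀ s ∈ P, IsSunletCopy s

instance sunletDec : DecidableRel sunlet8.Adj := fun a b => by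
  unfold sunlet8
  rw [SimpleGraph.fromRel_adj]
  infer_instance

/-- Base block, translated by `t`. -/
def blk (t : Fin 15 × Fin 3) (k : Fin 8) : Fin 15 × Fin 3 :=
  (t.1 + (![0, 1, 5, 2, 8, 7, 5, 12] : Fin 8 → Fin 15) k,
   t.2 + (![0, 0, 0, 0, 0, 0, 1, 0] : Fin 8 → Fin 3) k)

/-- The translate that contains a given edge. -/
def owner (u v : Fin 15 × Fin 3) : Fin 15 × Fin 3 :=
  if u.2 = v.2 then
    (u.1 - (![0, 0, 0, 2, 1, 12, 1, 8, 0, 7, 2, 5, 5, 2, 1] : Fin 15 → Fin 15) (v.1 - u.1), u.2)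
  else (u.1 - 5, if v.2 = u.2 + 1 then u.2 else v.2)

theorem blk_inj : ∀ t a b, blk t a = blk t b → a = b := by decide +kernel

theorem owner_blk : ∀ t a b, sunlet8.Adj a b → owner (blk t a) (blk t b) = t := by
  decide +kernel

theorem blk_adj : ∀ t a b, sunlet8.Adj a b →
    ((blk t a).1 ≠ (blk t b).1 ∧ (blk t a).2 = (blk t b).2) ∨
    ((blk t a).2 ≠ (blk t b).2 ∧ (blk t a).1 = (blk t b).1) := by
  decide +kernel

theorem cover : ∀ u v : Fin 15 × Fin 3, ((u.1 ≠ v.1 ∧ u.2 = v.2) ∨ (u.2 ≠ v.2 ∧ u.1 = v.1)) →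
    ∃ a, blk (owner u v) a = u ∧ ∃ b, blk (owner u v) b = v ∧ sunlet8.Adj a b := by
  decide +kernel

theorem stmt_18 :
    HasSunletDecomposition ((⊤ : SimpleGraph (Fin 15)) □ (⊤ : SimpleGraph (Fin 3))) := by
  refine ⟨Set.range fun t => Sym2.map (blk t) '' sunlet8.edgeSet, ?_, ?_, ?_⟩
  · ext e
    induction e using Sym2.ind with
    | _ u v =>
      rw [SimpleGraph.mem_edgeSet, SimpleGraph.boxProd_adj, SimpleGraph.top_adj,
        SimpleGraph.top_adj]
      constructor
      · rintro ⟨_, ⟨t, rfl⟩, e, he, h⟩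
        induction e using Sym2.ind with
        | _ a b =>
          rw [SimpleGraph.mem_edgeSet] at he
          rw [Sym2.map_mk, Sym2.eq_iff] at h
          rcases h with ⟨rfl, rfl⟩ | ⟨rfl, rfl⟩
          · exact blk_adj t a b he
          · exact blk_adj t b a he.symm
      · intro h
        obtain ⟨a, ha, b, hb, hab⟩ := cover u v h
        refine ⟨_, ⟨owner u v, rfl⟩, s(a, b), hab, ?_⟩
        rw [Sym2.map_mk, ha, hb]
  · rintro _ ⟨t, rfl⟩ _ ⟨t', rfl⟩ hne
    refine Set.disjoint_left.2 ?_
    rintro _ ⟨e, he, rfl⟩ ⟨e', he', h⟩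
    apply hne
    induction e using Sym2.ind with
    | _ a b =>
      induction e' using Sym2.ind with
      | _ c d =>
        rw [SimpleGraph.mem_edgeSet] at he he'
        rw [Sym2.map_mk, Sym2.map_mk, Sym2.eq_iff] at h
        have key : t = t' := by
          rcases h with ⟨h1, h2⟩ | ⟨h1, h2⟩
          · rw [← owner_blk t a b he, ← owner_blk t' c d he', h1, h2]
          · rw [← owner_blk t a b he, ← owner_blk t' d c he'.symm, h1, h2]
        rw [key]
  · rintro _ ⟨t, rfl⟩
    exact ⟨blk t, fun a b h => blk_inj t a b h, rfl⟩
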